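/- arXiv:2509.17578 — 2 statements merged into one kernel-verified Lean document; each statement's English description precedes it below -/
import Mathlib

section
/- Let p ≥ 2 and let A_p = [−π, π] if p is an even integer and A_p = [−π/2 + π/p, 3π/2 − π/p] otherwise. Then for every z = |z| e^{it} with t ∈ A_p, one has |Im z|^p ≤ a_p |Re z|^p + b_p |z|^p cos(p(π/2 − t)), where a_p = cot^p(π/(2p)) and b_p = 2 cos^p(π/(2p)) csc(π/p). -/
/-- `a_p = cot^p(π/(2p))`. -/
noncomputable def aP (p : ℝ) : ℝ := Real.cot (Real.pi / (2 * p)) ^ p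

/-- `b_p = 2 cos^p(π/(2p)) csc(π/p)`. -/
noncomputable def bP (p : ℝ) : ℝ :=
  2 * Real.cos (Real.pi / (2 * p)) ^ p * (Real.sin (Real.pi / p))⁻¹

open Classical in
/-- `A_p = [-π, π]` if `p` is an even integer, `[-π/2 + π/p, 3π/2 - π/p]` otherwise. -/
noncomputable def Ap (p : ℝ) : Set ℝ :=
  if ∃ n : ℤ, p = 2 * (n : ℝ) then Set.Icc (-Real.pi) Real.pi
  else Set.Icc (-(Real.pi / 2) + Real.pi / p) (3 * Real.pi / 2 - Real.pi / p)

open Real Set in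
/-- The factor of the derivative of `cos ^ (p - 1) * sin / sin (p ·)` that carries its sign. -/
lemma sin_mul_one_sub_sub_cos_mul_nonneg {p s : ℝ} (hp : 2 ≤ p) (hs0 : 0 ≤ s) (hs : s ≤ π / p) :
    0 ≤ sin (p * s) * (1 - p * sin s ^ 2) - p * cos (p * s) * (sin s * cos s) := by
  have hp0 : 0 < p := by linarith
  set k : ℝ → ℝ := fun x ↦ sin (p * x) * (1 - p * sin x ^ 2) - p * cos (p * x) * (sin x * cos x)
    with hk
  have hd : ∀ x, HasDerivAt k (p * (p - 2) * (sin x * sin ((p - 1) * x))) x := by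
    intro x
    have hl : HasDerivAt (fun x : ℝ ↦ p * x) p x := by
      simpa using (hasDerivAt_id x).const_mul p
    have h := (hl.sin.mul ((((hasDerivAt_sin x).pow 2).const_mul p).const_sub 1)).sub
      ((hl.cos.const_mul p).mul ((hasDerivAt_sin x).mul (hasDerivAt_cos x)))
    refine h.congr_deriv ?_
    rw [show (p - 1) * x = p * x - x by ring, sin_sub]
    simp only [Pi.pow_apply, Pi.mul_apply]
    push_cast
    linear_combination (-p * cos (p * x)) * (sin_sq_add_cos_sq x)
  have hmono : MonotoneOn k (Icc 0 (π / p)) := by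
    refine monotoneOn_of_hasDerivWithinAt_nonneg (convex_Icc _ _)
      (fun x _ ↦ (hd x).continuousAt.continuousWithinAt)
      (fun x _ ↦ (hd x).hasDerivWithinAt) ?_
    intro x hx
    rw [interior_Icc] at hx
    have hxp : p * x ≤ π := by
      have := (le_div_iff₀ hp0).1 hx.2.le
      linarith
    have h1 : 0 ≤ sin x := sin_nonneg_of_nonneg_of_le_pi hx.1.le (by nlinarith [hx.1])
    have h2 : 0 ≤ sin ((p - 1) * x) :=
      sin_nonneg_of_nonneg_of_le_pi (by nlinarith [hx.1]) (by nlinarith [hx.1])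
    have : 0 ≤ p - 2 := by linarith
    positivity
  have := hmono ⟨le_rfl, by positivity⟩ ⟨hs0, hs⟩ hs0
  simpa [hk] using this

open Real Set in
/-- The factor of the derivative of `sin ^ (p - 1) * cos / sin (p ·)` that carries its sign. -/
lemma sin_mul_sub_one_sub_cos_mul_nonneg {p s : ℝ} (hp : 2 ≤ p) (hs0 : 0 ≤ s) (hs : s ≤ π / p) :
    0 ≤ sin (p * s) * (p * cos s ^ 2 - 1) - p * cos (p * s) * (sin s * cos s) := by
  have hp0 : 0 < p := by linarith
  have hp1 : 0 < p - 1 := by linarith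
  have hpi := pi_pos
  set m : ℝ → ℝ := fun x ↦ sin (p * x) * (p * cos x ^ 2 - 1) - p * cos (p * x) * (sin x * cos x)
    with hm
  have hd : ∀ x, HasDerivAt m (p * (p - 2) * (cos x * cos ((p - 1) * x))) x := by
    intro x
    have hl : HasDerivAt (fun x : ℝ ↦ p * x) p x := by
      simpa using (hasDerivAt_id x).const_mul p
    have h := (hl.sin.mul ((((hasDerivAt_cos x).pow 2).const_mul p).sub_const 1)).sub
      ((hl.cos.const_mul p).mul ((hasDerivAt_sin x).mul (hasDerivAt_cos x)))
    refine h.congr_deriv ?_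
    rw [show (p - 1) * x = p * x - x by ring, cos_sub]
    simp only [Pi.pow_apply, Pi.mul_apply]
    push_cast
    linear_combination (p * cos (p * x)) * (sin_sq_add_cos_sq x)
  have hpp : 0 ≤ p - 2 := by linarith
  have hhalf : π / p ≤ π / 2 := by gcongr
  have hpip : p * (π / p) = π := by field_simp
  rcases le_total s (π / (2 * (p - 1))) with h | h
  · have hmono : MonotoneOn m (Icc 0 (π / (2 * (p - 1)))) := by
      refine monotoneOn_of_hasDerivWithinAt_nonneg (convex_Icc _ _)
        (fun x _ ↦ (hd x).continuousAt.continuousWithinAt)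
        (fun x _ ↦ (hd x).hasDerivWithinAt) ?_
      intro x hx
      rw [interior_Icc] at hx
      have hx2 : x * (2 * (p - 1)) ≤ π := (le_div_iff₀ (by positivity)).1 hx.2.le
      have h1 : 0 ≤ cos x := cos_nonneg_of_neg_pi_div_two_le_of_le (by linarith [hx.1])
        (by nlinarith [hx.1])
      have h2 : 0 ≤ cos ((p - 1) * x) := cos_nonneg_of_neg_pi_div_two_le_of_le
        (by nlinarith [hx.1]) (by linarith)
      positivity
    have := hmono ⟨le_rfl, by positivity⟩ ⟨hs0, h⟩ hs0
    simpa [hm] using this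
  · have hanti : AntitoneOn m (Icc (π / (2 * (p - 1))) (π / p)) := by
      refine antitoneOn_of_hasDerivWithinAt_nonpos (convex_Icc _ _)
        (fun x _ ↦ (hd x).continuousAt.continuousWithinAt)
        (fun x _ ↦ (hd x).hasDerivWithinAt) ?_
      intro x hx
      rw [interior_Icc] at hx
      have hx0 : 0 < x := lt_trans (by positivity) hx.1
      have hx1 : π ≤ x * (2 * (p - 1)) := (div_le_iff₀ (by positivity)).1 hx.1.le
      have hx2 : x * p ≤ π := (le_div_iff₀ hp0).1 hx.2.le
      have h1 : 0 ≤ cos x := cos_nonneg_of_neg_pi_div_two_le_of_le (by linarith)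
        (by linarith [hx.2])
      have h2 : cos ((p - 1) * x) ≤ 0 := cos_nonpos_of_pi_div_two_le_of_le
        (by linarith) (by linarith)
      exact mul_nonpos_of_nonneg_of_nonpos (by positivity)
        (mul_nonpos_of_nonneg_of_nonpos h1 h2)
    have := hanti ⟨h, hs⟩ ⟨h.trans hs, le_rfl⟩ hs
    refine le_trans ?_ this
    have h1 : 0 ≤ cos (π / p) := cos_nonneg_of_neg_pi_div_two_le_of_le
      (by linarith [hs0.trans hs]) hhalf
    have h2 : 0 ≤ sin (π / p) := sin_nonneg_of_nonneg_of_le_pi (hs0.trans hs) (by linarith)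
    simp only [hm, hpip, sin_pi, cos_pi]
    nlinarith [mul_nonneg hp0.le (mul_nonneg h2 h1)]

open Real Set in
lemma sin_pos_cos_pos_sin_mul_pos {p s : ℝ} (hp : 2 ≤ p) (hs : s ∈ Ioo 0 (π / p)) :
    0 < sin s ∧ 0 < cos s ∧ 0 < sin (p * s) := by
  have hp0 : 0 < p := by linarith
  have hpi := pi_pos
  have hhalf : π / p ≤ π / 2 := by gcongr
  have hsp : s * p < π := (lt_div_iff₀ hp0).1 hs.2
  exact ⟨sin_pos_of_pos_of_lt_pi hs.1 (by linarith [hs.2]),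
    cos_pos_of_mem_Ioo ⟨by linarith [hs.1], by linarith [hs.2]⟩,
    sin_pos_of_pos_of_lt_pi (mul_pos hp0 hs.1) (by linarith)⟩

open Real Set in
lemma monotoneOn_div_sin_mul {a p : ℝ} (ha : 0 ≤ a) (hp : 2 ≤ p) :
    MonotoneOn (fun s ↦ (a * (sin s ^ (p - 1) * cos s) + cos s ^ (p - 1) * sin s) / sin (p * s))
      (Ioo 0 (π / p)) := by
  have hd : ∀ x ∈ Ioo 0 (π / p), HasDerivAt
      (fun s ↦ (a * (sin s ^ (p - 1) * cos s) + cos s ^ (p - 1) * sin s) / sin (p * s))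
      ((a * (sin x ^ (p - 2) *
          (sin (p * x) * (p * cos x ^ 2 - 1) - p * cos (p * x) * (sin x * cos x))) +
        cos x ^ (p - 2) *
          (sin (p * x) * (1 - p * sin x ^ 2) - p * cos (p * x) * (sin x * cos x))) /
        sin (p * x) ^ 2) x := by
    intro x hx
    obtain ⟨hsin, hcos, hsp⟩ := sin_pos_cos_pos_sin_mul_pos hp hx
    have hl : HasDerivAt (fun x : ℝ ↦ p * x) p x := by
      simpa using (hasDerivAt_id x).const_mul p
    have h := (((((hasDerivAt_sin x).rpow_const (p := p - 1) (Or.inl hsin.ne')).mul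
      (hasDerivAt_cos x)).const_mul a).add
      (((hasDerivAt_cos x).rpow_const (p := p - 1) (Or.inl hcos.ne')).mul
      (hasDerivAt_sin x))).div hl.sin hsp.ne'
    refine h.congr_deriv ?_
    have e1 : sin x ^ (p - 1) = sin x ^ (p - 2) * sin x := by
      rw [← rpow_add_one hsin.ne']; ring_nf
    have e2 : cos x ^ (p - 1) = cos x ^ (p - 2) * cos x := by
      rw [← rpow_add_one hcos.ne']; ring_nf
    simp only [Pi.add_apply, Pi.mul_apply]
    rw [show p - 1 - 1 = p - 2 by ring, e1, e2]
    congr 1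
    linear_combination (-a * sin x ^ (p - 2) * sin (p * x) + cos x ^ (p - 2) * sin (p * x)) *
      (sin_sq_add_cos_sq x)
  refine monotoneOn_of_hasDerivWithinAt_nonneg (convex_Ioo _ _)
    (fun x hx ↦ (hd x hx).continuousAt.continuousWithinAt)
    (fun x hx ↦ (hd x (by rwa [interior_Ioo] at hx)).hasDerivWithinAt) ?_
  intro x hx
  rw [interior_Ioo] at hx
  obtain ⟨hsin, hcos, hsp⟩ := sin_pos_cos_pos_sin_mul_pos hp hx
  have h1 := sin_mul_one_sub_sub_cos_mul_nonneg hp hx.1.le hx.2.le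
  have h2 := sin_mul_sub_one_sub_cos_mul_nonneg hp hx.1.le hx.2.le
  positivity

open Real in
lemma pi_div_two_mul_mem_Ioo {p : ℝ} (hp : 2 ≤ p) : π / (2 * p) ∈ Set.Ioo 0 (π / p) := by
  have hp0 : 0 < p := by linarith
  refine ⟨by positivity, ?_⟩
  rw [div_lt_div_iff_of_pos_left pi_pos (by positivity) hp0]
  linarith

open Real in
lemma aP_mul_sin_rpow {p : ℝ} (hp : 2 ≤ p) :
    aP p * sin (π / (2 * p)) ^ p = cos (π / (2 * p)) ^ p := by
  obtain ⟨hsin, hcos, -⟩ := sin_pos_cos_pos_sin_mul_pos hp (pi_div_two_mul_mem_Ioo hp)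
  rw [aP, cot_eq_cos_div_sin, ← mul_rpow (by positivity) hsin.le, div_mul_cancel₀ _ hsin.ne']

open Real in
lemma aP_nonneg {p : ℝ} (hp : 2 ≤ p) : 0 ≤ aP p := by
  obtain ⟨hsin, hcos, -⟩ := sin_pos_cos_pos_sin_mul_pos hp (pi_div_two_mul_mem_Ioo hp)
  rw [aP, cot_eq_cos_div_sin]
  positivity

open Real in
lemma bP_nonneg {p : ℝ} (hp : 2 ≤ p) : 0 ≤ bP p := by
  have hp0 : 0 < p := by linarith
  obtain ⟨-, hcos, -⟩ := sin_pos_cos_pos_sin_mul_pos hp (pi_div_two_mul_mem_Ioo hp)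
  have : 0 ≤ sin (π / p) := sin_nonneg_of_nonneg_of_le_pi (by positivity)
    (div_le_self pi_pos.le (by linarith))
  rw [bP]
  positivity

open Real in
/-- `b_p` is the value at `π / (2p)` of the quotient in `monotoneOn_div_sin_mul`. -/
lemma div_sin_mul_eq_bP {p : ℝ} (hp : 2 ≤ p) :
    (aP p * (sin (π / (2 * p)) ^ (p - 1) * cos (π / (2 * p))) +
      cos (π / (2 * p)) ^ (p - 1) * sin (π / (2 * p))) / sin (p * (π / (2 * p))) = bP p := by
  have hp0 : 0 < p := by linarith
  obtain ⟨hsin, hcos, -⟩ := sin_pos_cos_pos_sin_mul_pos hp (pi_div_two_mul_mem_Ioo hp)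
  have ha := aP_mul_sin_rpow hp
  have e0 : p * (π / (2 * p)) = π / 2 := by field_simp
  have e1 : π / p = 2 * (π / (2 * p)) := by field_simp
  rw [e0, sin_pi_div_two, bP, e1, sin_two_mul, rpow_sub_one hsin.ne', rpow_sub_one hcos.ne']
  have e2 : aP p * (sin (π / (2 * p)) ^ p / sin (π / (2 * p)) * cos (π / (2 * p))) =
      cos (π / (2 * p)) ^ p / sin (π / (2 * p)) * cos (π / (2 * p)) := by
    rw [← ha]; ring
  rw [e2]
  field_simp
  linear_combination sin_sq_add_cos_sq (π / (2 * p))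

open Real Set in
lemma cos_rpow_le_of_le_pi_div {p s : ℝ} (hp : 2 ≤ p) (hs0 : 0 ≤ s) (hs : s ≤ π / p) :
    cos s ^ p ≤ aP p * sin s ^ p + bP p * cos (p * s) := by
  have hp0 : 0 < p := by linarith
  have hmem := pi_div_two_mul_mem_Ioo hp
  have hb := div_sin_mul_eq_bP hp
  have hmono := monotoneOn_div_sin_mul (aP_nonneg hp) hp
  set f : ℝ → ℝ := fun x ↦ aP p * sin x ^ p + bP p * cos (p * x) - cos x ^ p with hf
  have hd : ∀ x, HasDerivAt f (p * (aP p * (sin x ^ (p - 1) * cos x) + cos x ^ (p - 1) * sin x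
      - bP p * sin (p * x))) x := by
    intro x
    have hl : HasDerivAt (fun x : ℝ ↦ p * x) p x := by
      simpa using (hasDerivAt_id x).const_mul p
    have h := ((((hasDerivAt_sin x).rpow_const (p := p) (Or.inr (by linarith))).const_mul
      (aP p)).add (hl.cos.const_mul (bP p))).sub
      ((hasDerivAt_cos x).rpow_const (p := p) (Or.inr (by linarith)))
    refine h.congr_deriv ?_
    ring
  have hf0 : f (π / (2 * p)) = 0 := by
    have e0 : p * (π / (2 * p)) = π / 2 := by field_simp
    simp [hf, e0, aP_mul_sin_rpow hp]
  suffices 0 ≤ f s by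
    simp only [hf] at this
    linarith
  rw [← hf0]
  rcases le_total s (π / (2 * p)) with h | h
  · have hanti : AntitoneOn f (Icc 0 (π / (2 * p))) := by
      refine antitoneOn_of_hasDerivWithinAt_nonpos (convex_Icc _ _)
        (fun x _ ↦ (hd x).continuousAt.continuousWithinAt)
        (fun x _ ↦ (hd x).hasDerivWithinAt) ?_
      intro x hx
      rw [interior_Icc] at hx
      have hx' : x ∈ Ioo 0 (π / p) := ⟨hx.1, hx.2.trans hmem.2⟩
      have := hmono hx' hmem hx.2.le
      simp only [hb] at this
      have := (div_le_iff₀ (sin_pos_cos_pos_sin_mul_pos hp hx').2.2).1 this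
      exact mul_nonpos_of_nonneg_of_nonpos hp0.le (by linarith)
    exact hanti ⟨hs0, h⟩ ⟨hmem.1.le, le_rfl⟩ h
  · have hmonof : MonotoneOn f (Icc (π / (2 * p)) (π / p)) := by
      refine monotoneOn_of_hasDerivWithinAt_nonneg (convex_Icc _ _)
        (fun x _ ↦ (hd x).continuousAt.continuousWithinAt)
        (fun x _ ↦ (hd x).hasDerivWithinAt) ?_
      intro x hx
      rw [interior_Icc] at hx
      have hx' : x ∈ Ioo 0 (π / p) := ⟨hmem.1.trans hx.1, hx.2⟩
      have := hmono hmem hx' hx.1.le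
      simp only [hb] at this
      have := (le_div_iff₀ (sin_pos_cos_pos_sin_mul_pos hp hx').2.2).1 this
      exact mul_nonneg hp0.le (by linarith)
    exact hmonof ⟨le_rfl, hmem.2.le⟩ ⟨h, hs⟩ h

open Real in
lemma abs_cos_rpow_le_of_abs_le {p s : ℝ} (hp : 2 ≤ p) (hs : |s| ≤ π - π / p) :
    |cos s| ^ p ≤ aP p * |sin s| ^ p + bP p * cos (p * s) := by
  have hp0 : 0 < p := by linarith
  have hpi := pi_pos
  have hhalf : π / p ≤ π / 2 := by gcongr
  have hpos : 0 < π / p := by positivity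
  wlog hs0 : 0 ≤ s generalizing s
  · have := this (s := -s) (by rwa [abs_neg]) (by linarith)
    simpa using this
  rw [abs_of_nonneg hs0] at hs
  have hsin : 0 ≤ sin s := sin_nonneg_of_nonneg_of_le_pi hs0 (by linarith)
  rw [abs_of_nonneg hsin]
  rcases le_total s (π / p) with h | h
  · rw [abs_of_nonneg (cos_nonneg_of_neg_pi_div_two_le_of_le (by linarith) (by linarith))]
    exact cos_rpow_le_of_le_pi_div hp hs0 h
  have hend := cos_rpow_le_of_le_pi_div hp hpos.le le_rfl
  rw [show p * (π / p) = π by field_simp, cos_pi] at hend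
  have hc0 : 0 ≤ cos (π / p) := cos_nonneg_of_neg_pi_div_two_le_of_le (by linarith) hhalf
  have hs1 : 0 ≤ sin (π / p) := sin_nonneg_of_nonneg_of_le_pi hpos.le (by linarith)
  have hcos : |cos s| ≤ cos (π / p) := by
    rw [abs_le]
    constructor
    · rw [← cos_pi_sub]
      exact cos_le_cos_of_nonneg_of_le_pi hs0 (by linarith) hs
    · exact cos_le_cos_of_nonneg_of_le_pi hpos.le (by linarith) h
  have hsin' : sin (π / p) ≤ sin s := by
    refine abs_le_of_sq_le_sq' ?_ hsin |>.2
    have := sq_le_sq' (by linarith [neg_abs_le (cos s), abs_nonneg (cos s)]) hcos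
    rw [sq_abs] at this
    linarith [sin_sq_add_cos_sq s, sin_sq_add_cos_sq (π / p)]
  have h1 : |cos s| ^ p ≤ cos (π / p) ^ p := by gcongr
  have h2 : aP p * sin (π / p) ^ p ≤ aP p * sin s ^ p := by
    have := aP_nonneg hp
    gcongr
  have h3 : bP p * (-1) ≤ bP p * cos (p * s) :=
    mul_le_mul_of_nonneg_left (neg_one_le_cos _) (bP_nonneg hp)
  linarith

open Real in
lemma abs_sin_rpow_le_of_mem_Ap {p t : ℝ} (hp : 2 ≤ p) (ht : t ∈ Ap p) :
    |sin t| ^ p ≤ aP p * |cos t| ^ p + bP p * cos (p * (π / 2 - t)) := by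
  have hp0 : 0 < p := by linarith
  have hhalf : π / p ≤ π / 2 := by gcongr
  rw [← cos_pi_div_two_sub t, ← sin_pi_div_two_sub t]
  rw [Ap] at ht
  split_ifs at ht with hev
  · obtain ⟨n, hn⟩ := hev
    obtain ⟨ht1, ht2⟩ := ht
    rcases le_or_gt 0 t with h | h
    · exact abs_cos_rpow_le_of_abs_le hp (by rw [abs_le]; constructor <;> linarith)
    · have := abs_cos_rpow_le_of_abs_le hp (s := π / 2 - t - π)
        (by rw [abs_le]; constructor <;> linarith)
      rw [cos_sub_pi, sin_sub_pi, abs_neg, abs_neg] at this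
      rwa [show p * (π / 2 - t - π) = p * (π / 2 - t) - n * (2 * π) by rw [hn]; ring,
        cos_sub_int_mul_two_pi] at this
  · obtain ⟨ht1, ht2⟩ := ht
    exact abs_cos_rpow_le_of_abs_le hp (by rw [abs_le]; constructor <;> linarith)

/-- For `p ≥ 2` and `z = |z| e^{it}` with `t ∈ A_p`:
`|Im z|^p ≤ a_p |Re z|^p + b_p |z|^p cos(p(π/2 - t))`. -/
theorem im_rpow_le_aP_re_add_bP_cos (p : ℝ) (hp : 2 ≤ p) (z : ℂ) (t : ℝ)
    (ht : t ∈ Ap p) (hz : z = (‖z‖ : ℂ) * Complex.exp ((t : ℂ) * Complex.I)) :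
    |z.im| ^ p ≤ aP p * |z.re| ^ p + bP p * ‖z‖ ^ p * Real.cos (p * (Real.pi / 2 - t)) := by
  have hre : z.re = ‖z‖ * Real.cos t := by
    have := congrArg Complex.re hz
    rwa [Complex.re_ofReal_mul, Complex.exp_ofReal_mul_I_re] at this
  have him : z.im = ‖z‖ * Real.sin t := by
    have := congrArg Complex.im hz
    rwa [Complex.im_ofReal_mul, Complex.exp_ofReal_mul_I_im] at this
  rw [hre, him, abs_mul, abs_mul, abs_of_nonneg (norm_nonneg z),
    Real.mul_rpow (norm_nonneg z) (abs_nonneg _), Real.mul_rpow (norm_nonneg z) (abs_nonneg _)]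
  have := mul_le_mul_of_nonneg_left (abs_sin_rpow_le_of_mem_Ap hp ht)
    (Real.rpow_nonneg (norm_nonneg z) p)
  linarith
end

section
/- For every p ≥ 2 and every z ∈ ℂ, one has |z|^p ≤ m_p |Re z|^p − n_p Φ_p(z), where m_p = csc^p(π/(2p)) and n_p = cot(π/(2p)). -/
/-- Auxiliary function defining `φ` on `[-π/2, π/2]`. -/
noncomputable def phiAux (p t : ℝ) : ℝ :=
  if Real.pi / 2 - Real.pi / p ≤ |t| then -Real.cos (p * (Real.pi / 2 - |t|))
  else max |Real.cos (p * (Real.pi / 2 - t))| |Real.cos (p * (Real.pi / 2 + t))|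

/-- The function `φ` on `[-π, π]` (extended by `φ(t) = φ(π - |t|)` for `π/2 ≤ |t| ≤ π`). -/
noncomputable def phiP (p t : ℝ) : ℝ :=
  if |t| ≤ Real.pi / 2 then phiAux p t else phiAux p (Real.pi - |t|)

/-- The Verbitsky subharmonic function `Φ_p(r e^{it}) = r^p φ(t)`. -/
noncomputable def PhiP (p : ℝ) (z : ℂ) : ℝ := ‖z‖ ^ p * phiP p (Complex.arg z)

/-- `m_p = csc^p(π/(2p))`. -/
noncomputable def mP (p : ℝ) : ℝ := (Real.sin (Real.pi / (2 * p)))⁻¹ ^ p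

/-- `n_p = cot(π/(2p))`. -/
noncomputable def nP (p : ℝ) : ℝ := Real.cot (Real.pi / (2 * p))

open Real Set in
/-- The quotient `sin ^ (p - 1) * cos / sin (p ·)` is monotone on `(0, π / p)` when `2 ≤ p`. -/
theorem monotoneOn_sin_rpow_mul_cos_div_sin {p : ℝ} (hp : 2 ≤ p) :
    MonotoneOn (fun s : ℝ => sin s ^ (p - 1) * cos s / sin (p * s)) (Ioo 0 (π / p)) := by
  have hp0 : 0 < p := by linarith
  have key : ∀ s ∈ Ioo 0 (π / p), ∃ d, 0 ≤ d ∧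
      HasDerivAt (fun s : ℝ => sin s ^ (p - 1) * cos s / sin (p * s)) d s := by
    rintro s ⟨hs0, hs1⟩
    have hps : p * s < π := by rw [lt_div_iff₀ hp0] at hs1; linarith
    have hps0 : 0 < p * s := by positivity
    have hsπ : s < π / 2 := by nlinarith
    have hS : 0 < sin s := sin_pos_of_pos_of_lt_pi hs0 (by linarith)
    have hC : 0 < cos s := cos_pos_of_mem_Ioo ⟨by linarith, hsπ⟩
    have hD : 0 < sin (p * s) := sin_pos_of_pos_of_lt_pi hps0 hps
    have hd := (((hasDerivAt_sin s).rpow_const (p := p - 1) (Or.inl hS.ne')).mul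
      (hasDerivAt_cos s)).div (((hasDerivAt_id s).const_mul p).sin) hD.ne'
    refine ⟨_, ?_, hd⟩
    apply div_nonneg _ (sq_nonneg _)
    have hpow : sin s ^ (p - 1) = sin s ^ (p - 1 - 1) * sin s := by
      rw [← rpow_add_one hS.ne']; ring_nf
    have hq : 0 ≤ sin ((p - 1) * s) :=
      sin_nonneg_of_nonneg_of_le_pi (by nlinarith) (by nlinarith)
    have hr : 0 ≤ sin ((p - 1) * s - s) :=
      sin_nonneg_of_nonneg_of_le_pi (by nlinarith) (by nlinarith)
    rw [sin_sub] at hr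
    have e1 : sin (p * s) = sin ((p - 1) * s) * cos s + cos ((p - 1) * s) * sin s := by
      rw [← sin_add]; ring_nf
    have e2 : cos (p * s) = cos ((p - 1) * s) * cos s - sin ((p - 1) * s) * sin s := by
      rw [← cos_add]; ring_nf
    have hbr : 0 ≤ (p - 1) * (sin ((p - 1) * s) * cos s) - cos ((p - 1) * s) * sin s := by
      nlinarith [mul_nonneg (mul_nonneg hq hC.le) (by linarith : (0 : ℝ) ≤ p - 2)]
    have hmul := mul_nonneg (rpow_nonneg hS.le (p - 1 - 1)) hbr
    simp only [id, Pi.mul_apply]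
    rw [hpow, e1, e2]
    convert hmul using 1
    linear_combination (sin s ^ (p - 1 - 1) * (p * sin ((p - 1) * s) * cos s -
      (sin ((p - 1) * s) * cos s + cos ((p - 1) * s) * sin s))) * sin_sq_add_cos_sq s
  choose! d hd0 hd using key
  refine monotoneOn_of_deriv_nonneg (convex_Ioo _ _)
    (fun s hs => (hd s hs).continuousAt.continuousWithinAt) ?_ ?_
  · rw [interior_Ioo]
    exact fun s hs => (hd s hs).differentiableAt.differentiableWithinAt
  · rw [interior_Ioo]
    exact fun s hs => (hd s hs).deriv ▸ hd0 s hs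

open Real Set in
theorem one_le_mP_mul_sin_rpow_add_nP_mul_cos {p s : ℝ} (hp : 2 ≤ p) (hs0 : 0 ≤ s)
    (hs : s ≤ π / p) : 1 ≤ mP p * sin s ^ p + nP p * cos (p * s) := by
  have hp0 : 0 < p := by linarith
  have hπ := pi_pos
  unfold mP nP
  obtain ⟨a, ha⟩ : ∃ a, a = π / (2 * p) := ⟨_, rfl⟩
  rw [← ha]
  have hpa : p * a = π / 2 := by rw [ha]; field_simp
  have h2a : π / p = 2 * a := by rw [ha]; field_simp
  rw [h2a] at hs
  have ha0 : 0 < a := by rw [ha]; positivity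
  have ha4 : a ≤ π / 4 := by nlinarith
  have hSa : 0 < sin a := sin_pos_of_pos_of_lt_pi ha0 (by linarith)
  have hmono := monotoneOn_sin_rpow_mul_cos_div_sin hp
  rw [h2a] at hmono
  have hpow : sin a ^ p = sin a ^ (p - 1) * sin a := by
    rw [← rpow_add_one hSa.ne']; ring_nf
  have hSap : 0 < sin a ^ p := rpow_pos_of_pos hSa p
  set F : ℝ → ℝ := fun s => (sin a)⁻¹ ^ p * sin s ^ p + cot a * cos (p * s) with hF
  have hderiv : ∀ s, HasDerivAt F ((sin a)⁻¹ ^ p * (cos s * p * sin s ^ (p - 1))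
      + cot a * (-sin (p * s) * (p * 1))) s := fun s =>
    (((hasDerivAt_sin s).rpow_const (p := p) (Or.inr (by linarith))).const_mul _).add
      ((((hasDerivAt_id s).const_mul p).cos).const_mul _)
  have hcont : Continuous F := continuous_iff_continuousAt.2 fun s => (hderiv s).continuousAt
  have hform : ∀ s, (sin a)⁻¹ ^ p * (cos s * p * sin s ^ (p - 1))
      + cot a * (-sin (p * s) * (p * 1)) = p / sin a ^ p *
      (sin s ^ (p - 1) * cos s - sin a ^ (p - 1) * cos a * sin (p * s)) := by
    intro s
    have hw : sin a ^ (p - 1) ≠ 0 := (rpow_pos_of_pos hSa _).ne'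
    rw [inv_rpow hSa.le, cot_eq_cos_div_sin, hpow]
    field_simp
    ring
  have hD : ∀ s ∈ Ioo 0 (2 * a), 0 < sin (p * s) := fun s hs =>
    sin_pos_of_pos_of_lt_pi (mul_pos hp0 hs.1) (by nlinarith [hs.2])
  have ham : a ∈ Ioo 0 (2 * a) := ⟨ha0, by linarith⟩
  have hFa : F a = 1 := by
    simp only [hF]
    rw [hpa, cos_pi_div_two, inv_rpow hSa.le, mul_zero, add_zero, inv_mul_cancel₀ hSap.ne']
  change 1 ≤ F s
  rw [← hFa]
  rcases le_total s a with hsa | hsa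
  · have hanti : AntitoneOn F (Icc 0 a) := by
      refine antitoneOn_of_deriv_nonpos (convex_Icc _ _) hcont.continuousOn
        (fun x _ => (hderiv x).differentiableAt.differentiableWithinAt) ?_
      rw [interior_Icc]
      intro x hx
      have hxm : x ∈ Ioo 0 (2 * a) := ⟨hx.1, by linarith [hx.2]⟩
      have h := hmono hxm ham hx.2.le
      simp only [hpa, sin_pi_div_two, div_one] at h
      rw [div_le_iff₀ (hD x hxm)] at h
      rw [(hderiv x).deriv, hform]
      exact mul_nonpos_of_nonneg_of_nonpos (by positivity) (by linarith)
    exact hanti ⟨hs0, hsa⟩ ⟨ha0.le, le_rfl⟩ hsa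
  · have hmon : MonotoneOn F (Icc a (2 * a)) := by
      refine monotoneOn_of_deriv_nonneg (convex_Icc _ _) hcont.continuousOn
        (fun x _ => (hderiv x).differentiableAt.differentiableWithinAt) ?_
      rw [interior_Icc]
      intro x hx
      have hxm : x ∈ Ioo 0 (2 * a) := ⟨by linarith [hx.1], hx.2⟩
      have h := hmono ham hxm hx.1.le
      simp only [hpa, sin_pi_div_two, div_one] at h
      rw [le_div_iff₀ (hD x hxm)] at h
      rw [(hderiv x).deriv, hform]
      exact mul_nonneg (by positivity) (by linarith)
    exact hmon ⟨le_rfl, by linarith⟩ ⟨hsa, hs⟩ hsa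

open Real in
theorem nP_nonneg {p : ℝ} (hp : 2 ≤ p) : 0 ≤ nP p := by
  have h0 : 0 < π / (2 * p) := by have := pi_pos; positivity
  have h1 : π / (2 * p) ≤ π / 2 := by gcongr; linarith
  rw [nP, cot_eq_cos_div_sin]
  exact div_nonneg (cos_nonneg_of_mem_Icc ⟨by linarith [pi_pos], h1⟩)
    (sin_nonneg_of_nonneg_of_le_pi h0.le (by linarith [pi_pos]))

open Real in
theorem one_add_nP_le_mP_mul_sin_rpow {p s : ℝ} (hp : 2 ≤ p) (hs : π / p ≤ s)
    (hs' : s ≤ π / 2) : 1 + nP p ≤ mP p * sin s ^ p := by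
  have hp0 : 0 < p := by linarith
  have hπ := pi_pos
  unfold mP nP
  obtain ⟨a, ha⟩ : ∃ a, a = π / (2 * p) := ⟨_, rfl⟩
  rw [← ha]
  have hpa : p * a = π / 2 := by rw [ha]; field_simp
  have h2a : π / p = 2 * a := by rw [ha]; field_simp
  rw [h2a] at hs
  have ha0 : 0 < a := by rw [ha]; positivity
  have ha4 : a ≤ π / 4 := by nlinarith
  have hS : 0 < sin a := sin_pos_of_pos_of_lt_pi ha0 (by linarith)
  have hC : 0 < cos a := cos_pos_of_mem_Ioo ⟨by linarith, by linarith⟩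
  have hsin : 2 * sin a * cos a ≤ sin s := by
    rw [← sin_two_mul]
    exact sin_le_sin_of_le_of_le_pi_div_two (by linarith) hs' hs
  have hbase : 2 * cos a ≤ (sin a)⁻¹ * sin s := by
    rw [inv_mul_eq_div, le_div_iff₀ hS]; linarith
  have hc2 : 0 ≤ cos (2 * a) := cos_nonneg_of_mem_Icc ⟨by linarith, by linarith⟩
  have hsq : (2 * cos a) ^ 2 = 1 + (1 + 2 * cos (2 * a)) := by rw [cos_two_mul]; ring
  rw [← mul_rpow (inv_nonneg.2 hS.le) (sin_nonneg_of_nonneg_of_le_pi (by linarith) (by linarith))]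
  calc 1 + cot a ≤ 1 + p / 2 * (1 + 2 * cos (2 * a)) := by
        have hj : 2 / π * (2 * a) ≤ sin (2 * a) := mul_le_sin (by linarith) (by linarith)
        have hj' : 2 ≤ p * sin (2 * a) := by
          have : p * (2 / π * (2 * a)) = 2 := by
            rw [show p * (2 / π * (2 * a)) = 4 / π * (p * a) by ring, hpa]; field_simp; norm_num
          nlinarith
        rw [cot_eq_cos_div_sin, add_le_add_iff_left, div_le_iff₀ hS]
        rw [sin_two_mul] at hj'
        have hone : 1 ≤ p * sin a * cos a := by linarith
        have h1 : cos a * (2 * cos a * cos a) ≤ cos a * (1 + 2 * cos (2 * a)) := by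
          rw [cos_two_mul] at hc2 ⊢
          gcongr
          nlinarith
        have h2 := mul_le_mul_of_nonneg_left h1 (mul_pos hp0 hS).le
        have h3 : cos a * cos a ≤ p * sin a * cos a * (cos a * cos a) :=
          le_mul_of_one_le_left (by positivity) hone
        have h4 : cos a * cos a * 2 ≤ p * sin a * (1 + 2 * cos (2 * a)) * cos a := by nlinarith
        have h5 : cos a * 2 ≤ p * sin a * (1 + 2 * cos (2 * a)) :=
          le_of_mul_le_mul_right (by linarith) hC
        linarith
    _ ≤ (1 + (1 + 2 * cos (2 * a))) ^ (p / 2) :=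
        one_add_mul_self_le_rpow_one_add (by linarith) (by linarith)
    _ = (2 * cos a) ^ p := by
        rw [← hsq, ← rpow_natCast, ← rpow_mul (by positivity)]
        congr 1
        push_cast
        ring
    _ ≤ _ := rpow_le_rpow (by positivity) hbase hp0.le

open Real in
theorem one_le_mP_mul_cos_rpow_sub_nP_mul_phiAux {p t : ℝ} (hp : 2 ≤ p) (ht : |t| ≤ π / 2) :
    1 ≤ mP p * cos t ^ p - nP p * phiAux p t := by
  have hcos : cos t = sin (π / 2 - |t|) := by rw [sin_pi_div_two_sub, cos_abs]
  rw [hcos]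
  unfold phiAux
  split_ifs with h
  · have := one_le_mP_mul_sin_rpow_add_nP_mul_cos hp (s := π / 2 - |t|)
      (by linarith) (by linarith)
    linarith
  · have h1 := one_add_nP_le_mP_mul_sin_rpow hp (s := π / 2 - |t|)
      (by linarith) (by linarith [abs_nonneg t])
    have h2 := mul_le_mul_of_nonneg_left
      (max_le (abs_cos_le_one (p * (π / 2 - t))) (abs_cos_le_one (p * (π / 2 + t)))) (nP_nonneg hp)
    linarith

open Real in
theorem one_le_mP_mul_abs_cos_rpow_sub_nP_mul_phiP {p t : ℝ} (hp : 2 ≤ p) (ht : |t| ≤ π) :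
    1 ≤ mP p * |cos t| ^ p - nP p * phiP p t := by
  unfold phiP
  split_ifs with h
  · rw [abs_of_nonneg (cos_nonneg_of_mem_Icc (abs_le.1 h))]
    exact one_le_mP_mul_cos_rpow_sub_nP_mul_phiAux hp h
  · have h' : |(π - |t|)| ≤ π / 2 := by rw [abs_of_nonneg] <;> linarith
    have hcos : |cos t| = cos (π - |t|) := by
      rw [← abs_of_nonneg (cos_nonneg_of_mem_Icc (abs_le.1 h')), cos_pi_sub, cos_abs, abs_neg]
    rw [hcos]
    exact one_le_mP_mul_cos_rpow_sub_nP_mul_phiAux hp h'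

/-- For `p ≥ 2` and `z ∈ ℂ`: `|z|^p ≤ m_p |Re z|^p - n_p Φ_p(z)`. -/
theorem abs_rpow_le_mP_re_sub_nP_PhiP (p : ℝ) (hp : 2 ≤ p) (z : ℂ) :
    ‖z‖ ^ p ≤ mP p * |z.re| ^ p - nP p * PhiP p z := by
  have h := mul_le_mul_of_nonneg_left
    (one_le_mP_mul_abs_cos_rpow_sub_nP_mul_phiP hp (Complex.abs_arg_le_pi z))
    (Real.rpow_nonneg (norm_nonneg z) p)
  rw [← Complex.norm_mul_cos_arg z, abs_mul, abs_norm,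
    Real.mul_rpow (norm_nonneg z) (abs_nonneg _), PhiP]
  linarith
end
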